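/- Let p ∈ ℝ^{d_p} and q ∈ ℝ^{d_q} be probability distributions with H(p) > 0, H(q) > 0, V(p) > 0 and V(q) > 0, and let s denote a sharp distribution. Let (t_n) be a moderate sequence and set ε_n = 1 − e^{−n t_n²}. For ε ≥ 0 define R_n^{ent}(ε) = (1/n)·sup{ m ∈ ℕ : p^{⊗n} ⊗ s^{⊗m} ≺_ε q^{⊗m} ⊗ s^{⊗n} }, where ≺_ε is approximate majorisation with total variation error. Set ν = (V(p)/H(p)) / (V(q)/H(q)). Then lim_{n→∞} ( R_n^{ent}(ε_n) − H(p)/H(q) ) / t_n = +(√(2 V(p)) / H(q)) · (1 + 1/√ν). -/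

import Mathlib

open Finset Filter Real Topology

noncomputable section

/-- A probability distribution on a finite type: nonnegative entries summing to 1. -/
def IsProbDist {α : Type*} [Fintype α] (a : α → ℝ) : Prop :=
  (∀ i, 0 ≤ a i) ∧ ∑ i, a i = 1

/-- A sharp distribution: a single entry equal to 1, all others 0. -/
def IsSharp {α : Type*} [Fintype α] (a : α → ℝ) : Prop :=
  ∃ i, a i = 1 ∧ ∀ j, j ≠ i → a j = 0

/-- The uniform distribution: all entries equal to `1 / |α|`. -/
def IsUniform {α : Type*} [Fintype α] (a : α → ℝ) : Prop :=
  ∀ i, a i = 1 / (Fintype.card α : ℝ)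

/-- Tensor (Kronecker) product of two vectors. -/
def tensor {α β : Type*} (a : α → ℝ) (b : β → ℝ) : α × β → ℝ :=
  fun x => a x.1 * b x.2

/-- `n`-fold tensor power of a vector. -/
def tpow {α : Type*} (a : α → ℝ) (n : ℕ) : (Fin n → α) → ℝ :=
  fun f => ∏ j, a (f j)

/-- Shannon entropy (natural logarithm, with the convention `0 · ln 0 = 0`). -/
def shannonH {α : Type*} [Fintype α] (a : α → ℝ) : ℝ :=
  -∑ i, a i * Real.log (a i)

/-- Entropy variance `V(a) = ∑ i, a i (ln a i + H(a))²`. -/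
def entV {α : Type*} [Fintype α] (a : α → ℝ) : ℝ :=
  ∑ i, a i * (Real.log (a i) + shannonH a) ^ 2

/-- Relative entropy `D(a‖b)`. -/
def relD {α : Type*} [Fintype α] (a b : α → ℝ) : ℝ :=
  ∑ i, a i * Real.log (a i / b i)

/-- Relative entropy variance `V(a‖b)`. -/
def relV {α : Type*} [Fintype α] (a b : α → ℝ) : ℝ :=
  ∑ i, a i * (Real.log (a i / b i) - relD a b) ^ 2

/-- Total variation distance. -/
def tvd {α : Type*} [Fintype α] (a b : α → ℝ) : ℝ :=
  (1 / 2) * ∑ i, |a i - b i|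

/-- Fidelity `F(a,b) = (∑ i √(a i · b i))²`. -/
def fid {α : Type*} [Fintype α] (a b : α → ℝ) : ℝ :=
  (∑ i, Real.sqrt (a i * b i)) ^ 2

/-- The entries of `a` sorted in non-increasing order, as a vector on `Fin (card α)`. -/
def descSorted {α : Type*} [Fintype α] (a : α → ℝ) : Fin (Fintype.card α) → ℝ :=
  fun i =>
    a ((Fintype.equivFin α).symm
      (Tuple.sort (fun j => -a ((Fintype.equivFin α).symm j)) i))

/-- `headSum a K = ∑_{1 ≤ i ≤ K} a^↓_i` (1-based indices `i`, comparison `(i : ℝ) ≤ K`,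
equivalently `i ≤ ⌊K⌋`). -/
def headSum {α : Type*} [Fintype α] (a : α → ℝ) (K : ℝ) : ℝ :=
  ∑ i ∈ Finset.univ.filter (fun i : Fin (Fintype.card α) => ((i : ℕ) + 1 : ℝ) ≤ K),
    descSorted a i

/-- `tailSum a K = ∑_{i ≥ K} a^↓_i` (1-based indices `i`, comparison `K ≤ (i : ℝ)`,
equivalently `i ≥ ⌈K⌉`). -/
def tailSum {α : Type*} [Fintype α] (a : α → ℝ) (K : ℝ) : ℝ :=
  ∑ i ∈ Finset.univ.filter (fun i : Fin (Fintype.card α) => K ≤ ((i : ℕ) + 1 : ℝ)),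
    descSorted a i

/-- `a` majorises `b` (written `a ≻ b`): every partial sum of the non-increasingly sorted
`a` dominates the corresponding partial sum of sorted `b` (shorter vectors padded with zeros). -/
def Maj {α β : Type*} [Fintype α] [Fintype β] (a : α → ℝ) (b : β → ℝ) : Prop :=
  ∀ j : ℕ, headSum b (j : ℝ) ≤ headSum a (j : ℝ)

/-- `a ≻_ε b`: approximate majorisation (from above) with total variation error:
there is a probability distribution `b̃` with `a ≻ b̃` and `δ(b, b̃) ≤ ε`. -/
def ApproxMajTV {α β : Type*} [Fintype α] [Fintype β] (a : α → ℝ) (b : β → ℝ) (ε : ℝ) : Prop :=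
  ∃ bt : β → ℝ, IsProbDist bt ∧ Maj a bt ∧ tvd b bt ≤ ε

/-- `a ≺_ε b`: approximate majorisation (from below) with total variation error:
there is a probability distribution `b̃` with `a ≺ b̃` and `δ(b, b̃) ≤ ε`. -/
def ApproxSubMajTV {α β : Type*} [Fintype α] [Fintype β] (a : α → ℝ) (b : β → ℝ) (ε : ℝ) : Prop :=
  ∃ bt : β → ℝ, IsProbDist bt ∧ Maj bt a ∧ tvd b bt ≤ ε

/-- A moderate sequence: `t n → 0` and `√n · t n → +∞`. -/
def ModerateSeq (t : ℕ → ℝ) : Prop :=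
  Tendsto t atTop (𝓝 0) ∧ Tendsto (fun n : ℕ => Real.sqrt (n : ℝ) * t n) atTop atTop

/-- The uniform distribution on `Fin d`. -/
def unif (d : ℕ) : Fin d → ℝ := fun _ => 1 / (d : ℝ)

/-- The embedding map `Γ` associated with `γ_i = c_i / N`: for each `i` it produces
`c_i` entries equal to `a_i / c_i`. -/
def embed {d : ℕ} (c : Fin d → ℕ) (a : Fin d → ℝ) : (Σ i : Fin d, Fin (c i)) → ℝ :=
  fun x => a x.1 / (c x.1 : ℝ)

/-- Cut-and-pile modification of the sorted version of `a`, with cut at `K`: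
the first entry absorbs the total mass of entries at (1-based) positions `≥ K`,
entries at positions `1 < i < K` are unchanged, and entries at positions `≥ K` are set to 0. -/
def cutAndPile {α : Type*} [Fintype α] (a : α → ℝ) (K : ℝ) : Fin (Fintype.card α) → ℝ :=
  fun i =>
    if (i : ℕ) = 0 then descSorted a i + tailSum a K
    else if ((i : ℕ) + 1 : ℝ) < K then descSorted a i else 0

theorem exists_equiv_antitone_comp {α : Type*} [Fintype α] (b : α → ℝ) :
    ∃ e : Fin (Fintype.card α) ≃ α, Antitone (fun i => b (e i)) ∧
      ∀ i, descSorted b i = b (e i) := by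
  refine ⟨(Tuple.sort (fun j => -b ((Fintype.equivFin α).symm j))).trans
    (Fintype.equivFin α).symm, ?_, fun i => rfl⟩
  intro i k hik
  have h := Tuple.monotone_sort (fun j => -b ((Fintype.equivFin α).symm j)) hik
  simpa using h

theorem exists_sum_eq_headSum {α : Type*} [Fintype α] (b : α → ℝ) (j : ℕ) :
    ∃ T : Finset α, T.card ≤ j ∧ ∑ x ∈ T, b x = headSum b j := by
  obtain ⟨e, -, he⟩ := exists_equiv_antitone_comp b
  refine ⟨(Finset.univ.filter
    (fun i : Fin (Fintype.card α) => ((i : ℕ) + 1 : ℝ) ≤ j)).map e.toEmbedding, ?_, ?_⟩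
  · rw [Finset.card_map]
    calc _ ≤ (Finset.range j).card := by
          refine Finset.card_le_card_of_injOn (fun i => (i : ℕ)) ?_
            (fun x _ y _ h => Fin.ext h)
          intro i hi
          simp only [Finset.coe_filter, Finset.mem_univ, true_and, Set.mem_ofPred_eq] at hi
          have : (i : ℕ) + 1 ≤ j := by exact_mod_cast hi
          simpa using this
      _ = j := Finset.card_range j
  · rw [Finset.sum_map, headSum]
    exact Finset.sum_congr rfl fun i _ => (he i).symm

theorem sum_le_headSum {α : Type*} [Fintype α] {b : α → ℝ} (hb : ∀ x, 0 ≤ b x) {j : ℕ}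
    {T : Finset α} (hT : T.card ≤ j) : ∑ x ∈ T, b x ≤ headSum b j := by
  classical
  obtain ⟨e, hanti, he⟩ := exists_equiv_antitone_comp b
  have hsum : ∑ x ∈ T, b x = ∑ i ∈ T.map e.symm.toEmbedding, b (e i) := by
    rw [Finset.sum_map]; simp
  have hcard : (T.map e.symm.toEmbedding).card ≤ j := by rwa [Finset.card_map]
  rw [hsum, headSum]
  simp only [he]
  generalize T.map e.symm.toEmbedding = U at hcard
  set I := Finset.univ.filter
    (fun i : Fin (Fintype.card α) => ((i : ℕ) + 1 : ℝ) ≤ j) with hI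
  have memI : ∀ i : Fin (Fintype.card α), i ∈ I ↔ (i : ℕ) + 1 ≤ j := by
    intro i
    simp only [hI, Finset.mem_filter, Finset.mem_univ, true_and]
    exact_mod_cast Iff.rfl
  rcases le_or_gt (Fintype.card α) j with hj | hj
  · refine Finset.sum_le_sum_of_subset_of_nonneg (fun i _ => ?_) (fun i _ _ => hb _)
    rw [memI]; have := i.2; omega
  · have hIcard : j = I.card := by
      have h : I = Finset.Iio (⟨j, hj⟩ : Fin (Fintype.card α)) := by
        ext i
        rw [memI, Finset.mem_Iio, Fin.lt_def]
        exact Nat.succ_le_iff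
      rw [h, Fin.card_Iio]
    set c := b (e ⟨j, hj⟩)
    have h1 : ∑ i ∈ U \ I, b (e i) ≤ (U \ I).card • c := by
      refine Finset.sum_le_card_nsmul _ _ _ fun i hi => hanti ?_
      have := (Finset.mem_sdiff.1 hi).2
      rw [memI] at this
      rw [Fin.le_def]; simp; omega
    have h2 : (I \ U).card • c ≤ ∑ i ∈ I \ U, b (e i) := by
      refine Finset.card_nsmul_le_sum _ _ _ fun i hi => hanti ?_
      have := (Finset.mem_sdiff.1 hi).1
      rw [memI] at this
      rw [Fin.le_def]; simp; omega
    have h3 : (U \ I).card • c ≤ (I \ U).card • c := by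
      refine nsmul_le_nsmul_left (hb _) ?_
      have h4 := Finset.card_sdiff_add_card_inter U I
      have h5 := Finset.card_sdiff_add_card_inter I U
      rw [Finset.inter_comm I U] at h5
      omega
    have h6 := Finset.sum_inter_add_sum_sdiff U I (fun i => b (e i))
    have h7 := Finset.sum_inter_add_sum_sdiff I U (fun i => b (e i))
    rw [Finset.inter_comm I U] at h7
    linarith

theorem headSum_mono {α : Type*} [Fintype α] {b : α → ℝ} (hb : ∀ x, 0 ≤ b x) {j k : ℕ}
    (hjk : j ≤ k) : headSum b j ≤ headSum b k := by
  obtain ⟨T, hT, hs⟩ := exists_sum_eq_headSum b j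
  exact hs ▸ sum_le_headSum hb (hT.trans hjk)

theorem headSum_le_one {α : Type*} [Fintype α] {b : α → ℝ} (hb : IsProbDist b) (j : ℕ) :
    headSum b j ≤ 1 := by
  obtain ⟨T, -, hs⟩ := exists_sum_eq_headSum b j
  rw [← hs, ← hb.2]
  exact Finset.sum_le_sum_of_subset_of_nonneg (Finset.subset_univ T) fun i _ _ => hb.1 i

theorem headSum_zero {α : Type*} [Fintype α] (b : α → ℝ) : headSum b ((0 : ℕ) : ℝ) = 0 := by
  obtain ⟨T, hT, hs⟩ := exists_sum_eq_headSum b 0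
  rw [← hs, Finset.card_eq_zero.1 (Nat.le_zero.1 hT), Finset.sum_empty]

theorem sum_sub_sum_le_tvd {α : Type*} [Fintype α] {a b : α → ℝ} (ha : IsProbDist a)
    (hb : IsProbDist b) (T : Finset α) : ∑ x ∈ T, b x - ∑ x ∈ T, a x ≤ tvd a b := by
  classical
  have h1 : ∑ x ∈ T, (b x - a x) ≤ ∑ x ∈ T, |a x - b x| :=
    Finset.sum_le_sum fun x _ => by rw [abs_sub_comm]; exact le_abs_self _
  have h2 : ∑ x ∈ Tᶜ, (a x - b x) ≤ ∑ x ∈ Tᶜ, |a x - b x| :=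
    Finset.sum_le_sum fun x _ => le_abs_self _
  have h3 := Finset.sum_add_sum_compl T (fun x => |a x - b x|)
  have h4 := Finset.sum_add_sum_compl T a
  have h5 := Finset.sum_add_sum_compl T b
  rw [Finset.sum_sub_distrib] at h1 h2
  rw [ha.2] at h4
  rw [hb.2] at h5
  rw [tvd, ← h3]
  linarith

theorem ApproxSubMajTV.headSum_le {α β : Type*} [Fintype α] [Fintype β] {P : α → ℝ}
    {Q : β → ℝ} {e : ℝ} (hQ : IsProbDist Q) (h : ApproxSubMajTV P Q e) (j : ℕ) :
    headSum P j ≤ headSum Q j + e := by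
  obtain ⟨bt, hbt, hmaj, htv⟩ := h
  obtain ⟨T, hT, hs⟩ := exists_sum_eq_headSum bt j
  have h1 := sum_sub_sum_le_tvd hQ hbt T
  have h2 := sum_le_headSum hQ.1 hT
  have h3 := hmaj j
  linarith

theorem approxSubMajTV_of_headSum {α β : Type*} [Fintype α] [Fintype β] {P : α → ℝ}
    {Q : β → ℝ} {c : ℝ} (hP : IsProbDist P) (hQ : IsProbDist Q) (hc0 : 0 < c) (hc1 : c ≤ 1)
    {j : ℕ} (h1 : c ≤ headSum Q j) (h2 : headSum P j ≤ 1 - c) :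
    ApproxSubMajTV P Q (1 - c) := by
  classical
  obtain ⟨T, hT, hs⟩ := exists_sum_eq_headSum Q j
  set h := headSum Q j
  have hh : 0 < h := hc0.trans_le h1
  have hTne : T.Nonempty := by
    rw [Finset.nonempty_iff_ne_empty]
    rintro rfl
    rw [Finset.sum_empty] at hs
    exact hh.ne hs
  obtain ⟨x₀, hx₀⟩ := hTne
  set g : β → ℝ := fun x => if x ∈ T then c / h * Q x else 0 with hg
  have hg0 : ∀ x, 0 ≤ g x := fun x => by
    simp only [hg]
    split_ifs
    · exact mul_nonneg (div_pos hc0 hh).le (hQ.1 x)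
    · exact le_rfl
  have hgQ : ∀ x, g x ≤ Q x := fun x => by
    simp only [hg]
    split_ifs
    · exact mul_le_of_le_one_left (hQ.1 x) ((div_le_one hh).2 h1)
    · exact hQ.1 x
  have hgT : ∑ x ∈ T, g x = c := by
    rw [Finset.sum_congr rfl (fun x hx => if_pos hx), ← Finset.mul_sum, hs]
    field_simp
  have hgsum : ∑ x, g x = c := by
    rw [← hgT]
    exact (Finset.sum_subset (Finset.subset_univ T) (fun x _ hx => if_neg hx)).symm
  set d : β → ℝ := fun x => if x = x₀ then 1 - c else 0 with hd
  have hd0 : ∀ x, 0 ≤ d x := fun x => by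
    simp only [hd]; split_ifs <;> linarith
  have hdsum : ∑ x, d x = 1 - c := by simp [hd]
  have hdT : ∑ x ∈ T, d x = 1 - c := by simp [hd, hx₀]
  have hbt : IsProbDist (fun x => g x + d x) :=
    ⟨fun x => add_nonneg (hg0 x) (hd0 x), by rw [Finset.sum_add_distrib, hgsum, hdsum]; ring⟩
  refine ⟨fun x => g x + d x, hbt, fun k => ?_, ?_⟩
  · rcases lt_or_ge k j with hk | hk
    · rcases Nat.eq_zero_or_pos k with rfl | hk0
      · rw [headSum_zero, headSum_zero]
      · calc headSum P k ≤ headSum P j := headSum_mono hP.1 hk.le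
          _ ≤ 1 - c := h2
          _ ≤ ∑ x ∈ {x₀}, (g x + d x) := by
            rw [Finset.sum_singleton]
            have : d x₀ = 1 - c := if_pos rfl
            linarith [hg0 x₀]
          _ ≤ _ := sum_le_headSum hbt.1 (by rw [Finset.card_singleton]; exact hk0)
    · calc headSum P k ≤ 1 := headSum_le_one hP k
        _ = ∑ x ∈ T, (g x + d x) := by rw [Finset.sum_add_distrib, hgT, hdT]; ring
        _ ≤ _ := sum_le_headSum hbt.1 (hT.trans hk)
  · have : ∑ x, |Q x - (g x + d x)| ≤ ∑ x, ((Q x - g x) + d x) := by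
      refine Finset.sum_le_sum fun x _ => abs_le.2 ⟨?_, ?_⟩
      · linarith [hgQ x, hd0 x]
      · linarith [hd0 x]
    rw [Finset.sum_add_distrib, Finset.sum_sub_distrib, hgsum, hdsum, hQ.2] at this
    rw [tvd]
    linarith

/-- `Z` is the surprisal `-log W` on the support of `W`. -/
def IsSurprisal {α : Type*} (W Z : α → ℝ) : Prop :=
  ∀ x, W x = 0 ∨ W x = Real.exp (-Z x)

theorem headSum_le_of_isSurprisal {α : Type*} [Fintype α] {W Z : α → ℝ} (hW : IsProbDist W)
    (hZ : IsSurprisal W Z) {j : ℕ} {a b : ℝ} (hj : (j : ℝ) ≤ Real.exp a) :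
    headSum W j ≤ ∑ x with Z x < b, W x + Real.exp (a - b) := by
  classical
  obtain ⟨T, hT, hs⟩ := exists_sum_eq_headSum W j
  rw [← hs, ← Finset.sum_filter_add_sum_filter_not T (fun x => Z x < b)]
  refine add_le_add ?_ ?_
  · exact Finset.sum_le_sum_of_subset_of_nonneg
      (Finset.filter_subset_filter _ (Finset.subset_univ T)) fun i _ _ => hW.1 i
  · calc _ ≤ (T.filter fun x => ¬ Z x < b).card • Real.exp (-b) := by
          refine Finset.sum_le_card_nsmul _ _ _ fun x hx => ?_
          have hx2 := (Finset.mem_filter.1 hx).2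
          rcases hZ x with h | h
          · rw [h]; positivity
          · rw [h]; gcongr; exact not_lt.1 hx2
      _ ≤ Real.exp a * Real.exp (-b) := by
          rw [nsmul_eq_mul]
          gcongr
          refine le_trans ?_ hj
          exact_mod_cast (Finset.card_filter_le _ _).trans hT
      _ = _ := by rw [← Real.exp_add, sub_eq_add_neg]

theorem le_headSum_floor_of_isSurprisal {α : Type*} [Fintype α] {W Z : α → ℝ}
    (hW : IsProbDist W) (hZ : IsSurprisal W Z) (a : ℝ) :
    ∑ x with Z x ≤ a, W x ≤ headSum W (⌊Real.exp a⌋₊ : ℕ) := by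
  classical
  set T := (Finset.univ.filter fun x => Z x ≤ a).filter fun x => W x ≠ 0
  have h1 : ∑ x with Z x ≤ a, W x = ∑ x ∈ T, W x := (Finset.sum_filter_ne_zero _).symm
  rw [h1]
  refine sum_le_headSum hW.1 (Nat.le_floor ?_)
  have h2 : T.card • Real.exp (-a) ≤ ∑ x ∈ T, W x := by
    refine Finset.card_nsmul_le_sum _ _ _ fun x hx => ?_
    simp only [T, Finset.mem_filter, Finset.mem_univ, true_and] at hx
    rw [(hZ x).resolve_left hx.2]
    gcongr
    exact hx.1
  have h3 : ∑ x ∈ T, W x ≤ 1 := hW.2 ▸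
    Finset.sum_le_sum_of_subset_of_nonneg (Finset.subset_univ T) fun i _ _ => hW.1 i
  rw [nsmul_eq_mul, Real.exp_neg] at h2
  have h4 := h2.trans h3
  rwa [← div_eq_mul_inv, div_le_one (Real.exp_pos a)] at h4

theorem sum_mul_exp_le {α : Type*} [Fintype α] {W : α → ℝ} (hW : ∀ x, 0 ≤ W x) (S : α → ℝ)
    {θ₁ θ₂ c : ℝ} {T : Finset α} (hT : ∀ x ∈ T, c ≤ (θ₂ - θ₁) * S x) :
    ∑ x ∈ T, W x * Real.exp (θ₁ * S x) ≤ Real.exp (-c) * ∑ x, W x * Real.exp (θ₂ * S x) := by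
  rw [Finset.mul_sum]
  calc _ ≤ ∑ x ∈ T, Real.exp (-c) * (W x * Real.exp (θ₂ * S x)) := by
        refine Finset.sum_le_sum fun x hx => ?_
        rw [mul_left_comm, ← Real.exp_add]
        refine mul_le_mul_of_nonneg_left (Real.exp_le_exp.2 ?_) (hW x)
        linarith [hT x hx]
    _ ≤ _ := Finset.sum_le_sum_of_subset_of_nonneg (Finset.subset_univ T) fun x _ _ =>
        mul_nonneg (Real.exp_pos _).le (mul_nonneg (hW x) (Real.exp_pos _).le)

theorem sum_le_exp_mul {α : Type*} [Fintype α] {W : α → ℝ} (hW : ∀ x, 0 ≤ W x) (S : α → ℝ)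
    {θ c : ℝ} {T : Finset α} (hT : ∀ x ∈ T, c ≤ θ * S x) :
    ∑ x ∈ T, W x ≤ Real.exp (-c) * ∑ x, W x * Real.exp (θ * S x) := by
  have := sum_mul_exp_le hW S (θ₁ := 0) (θ₂ := θ) (c := c) (T := T) (by simpa using hT)
  simpa using this

/-- Tail lower bound from two-sided Gaussian-type bounds on the moment generating function. -/
theorem two_mul_exp_le_tail {α : Type*} [Fintype α] {W : α → ℝ} (hW : ∀ x, 0 ≤ W x)
    (S : α → ℝ) {A δ r : ℝ} (hA : 0 ≤ A) (hδ0 : 0 < δ) (hδ1 : δ < 1) (hr : 0 < r)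
    (hM : ∀ θ, |θ| ≤ r →
      Real.exp (A * θ ^ 2 / 2 * (1 - δ ^ 2 / 64)) ≤ ∑ x, W x * Real.exp (θ * S x) ∧
      ∑ x, W x * Real.exp (θ * S x) ≤ Real.exp (A * θ ^ 2 / 2 * (1 + δ ^ 2 / 64)))
    (hAr : Real.log 4 ≤ A * r ^ 2 * (δ ^ 2 / 64)) :
    2 * Real.exp (-(A * r ^ 2 / 2)) ≤ ∑ x with (1 - δ) * (A * r) ≤ S x, W x := by
  classical
  have hδδ : δ ^ 2 ≤ δ := by nlinarith
  have hAr0 : 0 ≤ A * r ^ 2 := by positivity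
  have hs1 : (1 - δ / 4) ^ 2 ≤ 1 :=
    pow_le_one₀ (by linarith) (by linarith)
  have hs2 : (1 - δ / 2) ^ 2 ≤ 1 :=
    pow_le_one₀ (by linarith) (by linarith)
  have hs3 : (1 - 3 * δ / 4) ^ 2 ≤ 1 :=
    pow_le_one₀ (by linarith) (by linarith)
  set θ := (1 - δ / 2) * r with hθ
  set ρ := δ / 4 * r with hρ
  have hρ0 : 0 < ρ := by positivity
  have hθ0 : 0 < θ := mul_pos (by linarith) hr
  set M := ∑ x, W x * Real.exp (θ * S x) with hMdef
  have habs : ∀ z, 0 ≤ z → z ≤ 1 → |z * r| ≤ r := fun z h0 h1 => by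
    rw [abs_of_nonneg (mul_nonneg h0 hr.le)]; nlinarith
  have hMl : Real.exp (A * θ ^ 2 / 2 * (1 - δ ^ 2 / 64)) ≤ M :=
    (hM θ (habs _ (by linarith) (by linarith))).1
  have hp : ∑ x, W x * Real.exp ((θ + ρ) * S x)
      ≤ Real.exp (A * (θ + ρ) ^ 2 / 2 * (1 + δ ^ 2 / 64)) := by
    refine (hM (θ + ρ) ?_).2
    have : θ + ρ = (1 - δ / 4) * r := by rw [hθ, hρ]; ring
    rw [this]; exact habs _ (by linarith) (by linarith)
  have hm : ∑ x, W x * Real.exp ((θ - ρ) * S x)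
      ≤ Real.exp (A * (θ - ρ) ^ 2 / 2 * (1 + δ ^ 2 / 64)) := by
    refine (hM (θ - ρ) ?_).2
    have : θ - ρ = (1 - 3 * δ / 4) * r := by rw [hθ, hρ]; ring
    rw [this]; exact habs _ (by linarith) (by linarith)
  have h4 : Real.exp (-Real.log 4) = 1 / 4 := by
    rw [Real.exp_neg, Real.exp_log (by norm_num)]; norm_num
  have hhigh : ∑ x with A * (θ + ρ) < S x, W x * Real.exp (θ * S x) ≤ M / 4 := by
    calc _ ≤ Real.exp (-(ρ * (A * (θ + ρ)))) * ∑ x, W x * Real.exp ((θ + ρ) * S x) := by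
          refine sum_mul_exp_le hW S fun x hx => ?_
          rw [add_sub_cancel_left]
          exact mul_le_mul_of_nonneg_left (Finset.mem_filter.1 hx).2.le hρ0.le
      _ ≤ Real.exp (-(ρ * (A * (θ + ρ)))) *
          Real.exp (A * (θ + ρ) ^ 2 / 2 * (1 + δ ^ 2 / 64)) := by gcongr
      _ ≤ Real.exp (A * θ ^ 2 / 2 * (1 - δ ^ 2 / 64)) * Real.exp (-Real.log 4) := by
          rw [← Real.exp_add, ← Real.exp_add, Real.exp_le_exp]
          have key : -(ρ * (A * (θ + ρ))) + A * (θ + ρ) ^ 2 / 2 * (1 + δ ^ 2 / 64)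
            = A * θ ^ 2 / 2 * (1 - δ ^ 2 / 64) - A * r ^ 2 * (δ ^ 2 / 64)
              - A * r ^ 2 * (δ ^ 2 / 128) *
                (2 - (1 - δ / 4) ^ 2 - (1 - δ / 2) ^ 2) := by
            rw [hθ, hρ]; ring
          rw [key]
          have : 0 ≤ A * r ^ 2 * (δ ^ 2 / 128) * (2 - (1 - δ / 4) ^ 2 - (1 - δ / 2) ^ 2) :=
            mul_nonneg (by positivity) (by linarith)
          linarith
      _ ≤ M / 4 := by rw [h4]; linarith
  have hlow : ∑ x with S x < A * (θ - ρ), W x * Real.exp (θ * S x) ≤ M / 4 := by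
    calc _ ≤ Real.exp (-(-ρ * (A * (θ - ρ)))) * ∑ x, W x * Real.exp ((θ - ρ) * S x) := by
          refine sum_mul_exp_le hW S fun x hx => ?_
          have := mul_le_mul_of_nonneg_left (Finset.mem_filter.1 hx).2.le hρ0.le
          linarith
      _ ≤ Real.exp (-(-ρ * (A * (θ - ρ)))) *
          Real.exp (A * (θ - ρ) ^ 2 / 2 * (1 + δ ^ 2 / 64)) := by gcongr
      _ ≤ Real.exp (A * θ ^ 2 / 2 * (1 - δ ^ 2 / 64)) * Real.exp (-Real.log 4) := by
          rw [← Real.exp_add, ← Real.exp_add, Real.exp_le_exp]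
          have key : -(-ρ * (A * (θ - ρ))) + A * (θ - ρ) ^ 2 / 2 * (1 + δ ^ 2 / 64)
            = A * θ ^ 2 / 2 * (1 - δ ^ 2 / 64) - A * r ^ 2 * (δ ^ 2 / 64)
              - A * r ^ 2 * (δ ^ 2 / 128) *
                (2 - (1 - 3 * δ / 4) ^ 2 - (1 - δ / 2) ^ 2) := by
            rw [hθ, hρ]; ring
          rw [key]
          have : 0 ≤ A * r ^ 2 * (δ ^ 2 / 128) * (2 - (1 - 3 * δ / 4) ^ 2 - (1 - δ / 2) ^ 2) :=
            mul_nonneg (by positivity) (by linarith)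
          linarith
      _ ≤ M / 4 := by rw [h4]; linarith
  set D := Finset.univ.filter fun x => (1 - δ) * (A * r) ≤ S x ∧ S x ≤ A * (θ + ρ) with hD
  have hmid : M / 2 ≤ ∑ x ∈ D, W x * Real.exp (θ * S x) := by
    have hcover : M ≤ ∑ x ∈ D, W x * Real.exp (θ * S x)
        + (∑ x with A * (θ + ρ) < S x, W x * Real.exp (θ * S x)
        + ∑ x with S x < A * (θ - ρ), W x * Real.exp (θ * S x)) := by
      rw [hD, hMdef, Finset.sum_filter, Finset.sum_filter, Finset.sum_filter,
        ← Finset.sum_add_distrib, ← Finset.sum_add_distrib]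
      refine Finset.sum_le_sum fun x _ => ?_
      have h0 : 0 ≤ W x * Real.exp (θ * S x) := mul_nonneg (hW x) (Real.exp_pos _).le
      have hle : (1 - δ) * (A * r) ≤ A * (θ - ρ) := by
        have : 0 ≤ A * r * (δ / 4) := by positivity
        rw [hθ, hρ]; linarith
      split_ifs with h1 h2 h3 h3 h2 h3 h3
      all_goals first | linarith | skip
      exact absurd ⟨hle.trans (not_lt.1 h3), not_lt.1 h2⟩ h1
    linarith
  have hend : Real.exp (-(θ * (A * (θ + ρ)))) * ∑ x ∈ D, W x * Real.exp (θ * S x)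
      ≤ ∑ x with (1 - δ) * (A * r) ≤ S x, W x := by
    rw [Finset.mul_sum]
    calc _ ≤ ∑ x ∈ D, W x := by
          refine Finset.sum_le_sum fun x hx => ?_
          rw [mul_left_comm, ← Real.exp_add]
          refine mul_le_of_le_one_right (hW x) (Real.exp_le_one_iff.2 ?_)
          have := mul_le_mul_of_nonneg_left (Finset.mem_filter.1 hx).2.2 hθ0.le
          linarith
      _ ≤ _ := Finset.sum_le_sum_of_subset_of_nonneg (fun x hx => by
          simp only [hD, Finset.mem_filter, Finset.mem_univ, true_and] at hx ⊢
          exact hx.1) fun x _ _ => hW x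
  calc 2 * Real.exp (-(A * r ^ 2 / 2))
      ≤ Real.exp (-(θ * (A * (θ + ρ)))) *
        (Real.exp (A * θ ^ 2 / 2 * (1 - δ ^ 2 / 64)) / 2) := by
        have h5 : Real.exp (Real.log 4) = 4 := Real.exp_log (by norm_num)
        have h6 : Real.exp (-(A * r ^ 2 / 2)) * Real.exp (Real.log 4)
            ≤ Real.exp (-(θ * (A * (θ + ρ)))) *
              Real.exp (A * θ ^ 2 / 2 * (1 - δ ^ 2 / 64)) := by
          rw [← Real.exp_add, ← Real.exp_add, Real.exp_le_exp]
          have key : -(θ * (A * (θ + ρ))) + A * θ ^ 2 / 2 * (1 - δ ^ 2 / 64)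
            = -(A * r ^ 2 / 2) + A * r ^ 2 * (δ ^ 2 / 64)
              + A * r ^ 2 * (δ / 4 - δ ^ 2 / 64 - (1 - δ / 2) ^ 2 * (δ ^ 2 / 128)) := by
            rw [hθ, hρ]; ring
          rw [key]
          have : 0 ≤ A * r ^ 2 * (δ / 4 - δ ^ 2 / 64 - (1 - δ / 2) ^ 2 * (δ ^ 2 / 128)) := by
            refine mul_nonneg hAr0 ?_
            have h8 : (1 - δ / 2) ^ 2 * (δ ^ 2 / 128) ≤ 1 * (δ ^ 2 / 128) := by gcongr
            linarith
          linarith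
        rw [h5] at h6
        linarith
    _ ≤ Real.exp (-(θ * (A * (θ + ρ)))) * ∑ x ∈ D, W x * Real.exp (θ * S x) := by
        gcongr
        linarith
    _ ≤ _ := hend

/-- Two-sided Gaussian bounds near the origin for the moment generating function of a centred
function. -/
theorem exists_mgf_bounds {α : Type*} [Fintype α] {w f : α → ℝ} (hw : IsProbDist w) {V : ℝ}
    (hV : 0 < V) (h1 : ∑ i, w i * f i = 0) (h2 : ∑ i, w i * f i ^ 2 = V) {η : ℝ} (hη : 0 < η)
    (hη1 : η < 1) :
    ∃ θ₀ > 0, ∀ θ, |θ| ≤ θ₀ →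
      Real.exp (V * θ ^ 2 / 2 * (1 - η)) ≤ ∑ i, w i * Real.exp (θ * f i) ∧
      ∑ i, w i * Real.exp (θ * f i) ≤ Real.exp (V * θ ^ 2 / 2 * (1 + η)) := by
  set B := 1 + ∑ i, |f i| with hB
  have hBpos : 0 < B := by
    have : 0 ≤ ∑ i, |f i| := Finset.sum_nonneg fun i _ => abs_nonneg _
    linarith
  have hfB : ∀ i, |f i| ≤ B := fun i => by
    have := Finset.single_le_sum (f := fun i => |f i|) (fun i _ => abs_nonneg _)
      (Finset.mem_univ i)
    linarith
  have hc : 0 < V * η / (2 * (B ^ 3 + V ^ 2 + 1)) := by positivity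
  refine ⟨min 1 (min (1 / B) (min (1 / V) (V * η / (2 * (B ^ 3 + V ^ 2 + 1))))), by positivity,
    fun θ hθ => ?_⟩
  obtain ⟨ht1, hθ⟩ := le_min_iff.1 hθ
  obtain ⟨ht2, hθ⟩ := le_min_iff.1 hθ
  obtain ⟨ht3, ht4⟩ := le_min_iff.1 hθ
  rw [le_div_iff₀ hBpos] at ht2
  rw [le_div_iff₀ hV] at ht3
  rw [le_div_iff₀ (by positivity)] at ht4
  have h0 := abs_nonneg θ
  have hsq : |θ| ^ 2 = θ ^ 2 := sq_abs θ
  have hterm : ∀ i, |Real.exp (θ * f i) - (1 + θ * f i + θ ^ 2 * f i ^ 2 / 2)|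
      ≤ B ^ 3 * |θ| ^ 3 := by
    intro i
    have hx : |θ * f i| ≤ 1 := by
      rw [abs_mul]
      exact (mul_le_mul_of_nonneg_left (hfB i) h0).trans ht2
    have := Real.exp_bound hx (n := 3) (by norm_num)
    simp only [Finset.sum_range_succ, Finset.sum_range_zero, Nat.factorial] at this
    have e1 : |θ * f i| ^ 3 ≤ B ^ 3 * |θ| ^ 3 := by
      rw [abs_mul, mul_pow, mul_comm]
      gcongr
      exact hfB i
    have e2 : 0 ≤ |θ * f i| ^ 3 := by positivity
    norm_num [mul_pow] at this
    rw [abs_mul, mul_pow] at e1 e2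
    linarith
  have hM : |∑ i, w i * Real.exp (θ * f i) - (1 + V * θ ^ 2 / 2)| ≤ B ^ 3 * |θ| ^ 3 := by
    have e : ∑ i, w i * Real.exp (θ * f i) - (1 + V * θ ^ 2 / 2)
        = ∑ i, w i * (Real.exp (θ * f i) - (1 + θ * f i + θ ^ 2 * f i ^ 2 / 2)) := by
      have e3 : ∀ i, w i * (Real.exp (θ * f i) - (1 + θ * f i + θ ^ 2 * f i ^ 2 / 2))
          = w i * Real.exp (θ * f i) - w i - θ * (w i * f i) - θ ^ 2 / 2 * (w i * f i ^ 2) :=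
        fun i => by ring
      simp only [e3, Finset.sum_sub_distrib, ← Finset.mul_sum, h1, h2, hw.2]
      ring
    rw [e]
    calc _ ≤ ∑ i, |w i * (Real.exp (θ * f i) - (1 + θ * f i + θ ^ 2 * f i ^ 2 / 2))| :=
          Finset.abs_sum_le_sum_abs _ _
      _ ≤ ∑ i, w i * (B ^ 3 * |θ| ^ 3) := by
          refine Finset.sum_le_sum fun i _ => ?_
          rw [abs_mul, abs_of_nonneg (hw.1 i)]
          exact mul_le_mul_of_nonneg_left (hterm i) (hw.1 i)
      _ = _ := by rw [← Finset.sum_mul, hw.2, one_mul]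
  rw [abs_le] at hM
  have hθ2 : 0 ≤ θ ^ 2 := sq_nonneg θ
  have hcub : B ^ 3 * |θ| ^ 3 + V ^ 2 * θ ^ 4 ≤ V * θ ^ 2 / 2 * η := by
    have e4 : θ ^ 4 = θ ^ 2 * |θ| ^ 2 := by rw [hsq]; ring
    have e5 : |θ| ^ 3 = θ ^ 2 * |θ| := by rw [← hsq]; ring
    have e6 : |θ| ^ 2 ≤ |θ| := by nlinarith
    have e7 : (B ^ 3 + V ^ 2) * |θ| ≤ V * η / 2 := by nlinarith
    calc B ^ 3 * |θ| ^ 3 + V ^ 2 * θ ^ 4 = θ ^ 2 * (B ^ 3 * |θ| + V ^ 2 * |θ| ^ 2) := by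
          rw [e4, e5]; ring
      _ ≤ θ ^ 2 * (V * η / 2) := by
          gcongr
          have := mul_le_mul_of_nonneg_left e6 (sq_nonneg V)
          linarith
      _ = _ := by ring
  have hq4 : 0 ≤ V ^ 2 * θ ^ 4 := by positivity
  have hc3 : 0 ≤ B ^ 3 * |θ| ^ 3 := by positivity
  constructor
  · set y := V * θ ^ 2 / 2 * (1 - η) with hy
    have hv0 : 0 ≤ V * θ ^ 2 / 2 := by positivity
    have hy0 : 0 ≤ y := mul_nonneg hv0 (by linarith)
    have hyle : y ≤ V * θ ^ 2 / 2 := mul_le_of_le_one_right hv0 (by linarith)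
    have hvt : V * θ ^ 2 ≤ 1 := by
      rw [← hsq]; nlinarith
    have hexp := Real.abs_exp_sub_one_sub_id_le (x := y)
      (by rw [abs_of_nonneg hy0]; linarith)
    have h5 := (abs_le.1 hexp).2
    have h6 : y ^ 2 ≤ (V * θ ^ 2 / 2) ^ 2 := by gcongr
    have h7 : (V * θ ^ 2 / 2) ^ 2 = V ^ 2 * θ ^ 4 / 4 := by ring
    have h8 : y = V * θ ^ 2 / 2 - V * θ ^ 2 / 2 * η := by rw [hy]; ring
    linarith
  · have h5 := Real.add_one_le_exp (V * θ ^ 2 / 2 * (1 + η))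
    have h6 : V * θ ^ 2 / 2 * (1 + η) = V * θ ^ 2 / 2 + V * θ ^ 2 / 2 * η := by ring
    linarith

theorem isProbDist_tpow {α : Type*} [Fintype α] {a : α → ℝ} (ha : IsProbDist a) (n : ℕ) :
    IsProbDist (tpow a n) := by
  classical
  refine ⟨fun x => Finset.prod_nonneg fun i _ => ha.1 _, ?_⟩
  have h := Fintype.sum_pow a n
  rw [ha.2, one_pow] at h
  exact h.symm

theorem isProbDist_tensor {α β : Type*} [Fintype α] [Fintype β] {a : α → ℝ} {b : β → ℝ}
    (ha : IsProbDist a) (hb : IsProbDist b) : IsProbDist (tensor a b) := by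
  refine ⟨fun x => mul_nonneg (ha.1 _) (hb.1 _), ?_⟩
  rw [Fintype.sum_prod_type]
  simp only [tensor, ← Finset.mul_sum, hb.2, mul_one, ha.2]

/-- The surprisal of a tensor power, as a function on the outcomes of `tpow p n ⊗ tpow s k`. -/
def surprisal {α β : Type*} (p : α → ℝ) (n k : ℕ) : (Fin n → α) × (Fin k → β) → ℝ :=
  fun x => ∑ j, -Real.log (p (x.1 j))

theorem isSurprisal_tensor {α β : Type*} [Fintype α] [Fintype β] {p : α → ℝ} {s : β → ℝ}
    (hp : IsProbDist p) (hs : IsSharp s) (n k : ℕ) :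
    IsSurprisal (tensor (tpow p n) (tpow s k)) (surprisal p n k) := by
  rintro ⟨x, y⟩
  obtain ⟨i₀, hi₀, hi⟩ := hs
  by_cases hx : ∃ j, p (x j) = 0
  · obtain ⟨j, hj⟩ := hx
    left
    have : tpow p n x = 0 := Finset.prod_eq_zero (Finset.mem_univ j) hj
    simp [tensor, this]
  by_cases hy : ∃ j, y j ≠ i₀
  · obtain ⟨j, hj⟩ := hy
    left
    have : tpow s k y = 0 := Finset.prod_eq_zero (Finset.mem_univ j) (hi _ hj)
    simp [tensor, this]
  push Not at hx hy
  right
  have h1 : tpow s k y = 1 := Finset.prod_eq_one fun j _ => by rw [hy j, hi₀]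
  change tpow p n x * tpow s k y = _
  rw [h1, mul_one]
  simp only [surprisal, Finset.sum_neg_distrib, neg_neg, Real.exp_sum, tpow]
  exact Finset.prod_congr rfl fun j _ =>
    (Real.exp_log (lt_of_le_of_ne (hp.1 _) (hx j).symm)).symm

theorem mgf_tensor {α β : Type*} [Fintype α] [Fintype β] (p : α → ℝ) {s : β → ℝ}
    (hs : IsProbDist s) (n k : ℕ) (θ h : ℝ) :
    ∑ x, tensor (tpow p n) (tpow s k) x * Real.exp (θ * (surprisal p n k x - n * h))
      = (∑ i, p i * Real.exp (θ * (-Real.log (p i) - h))) ^ n := by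
  classical
  rw [Fintype.sum_prod_type, Fintype.sum_pow]
  refine Finset.sum_congr rfl fun x _ => ?_
  have e : ∀ y, tensor (tpow p n) (tpow s k) (x, y)
      * Real.exp (θ * (surprisal p n k (x, y) - n * h))
      = tpow s k y * (tpow p n x * Real.exp (θ * ((∑ j, -Real.log (p (x j))) - n * h))) :=
    fun y => by simp only [tensor, surprisal]; ring
  simp only [e]
  rw [← Finset.sum_mul, (isProbDist_tpow hs k).2, one_mul, Finset.prod_mul_distrib, ← Real.exp_sum,
    ← Finset.mul_sum, Finset.sum_sub_distrib]
  simp [tpow]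

theorem exists_mgf_tensor_bounds {α : Type*} [Fintype α] {p : α → ℝ} (hp : IsProbDist p)
    (hV : 0 < entV p) {η : ℝ} (hη : 0 < η) (hη1 : η < 1) :
    ∃ θ₀ > 0, ∀ (θ : ℝ), |θ| ≤ θ₀ → ∀ {β : Type} [Fintype β] {s : β → ℝ}, IsProbDist s →
      ∀ n k : ℕ,
      Real.exp (n * entV p * θ ^ 2 / 2 * (1 - η)) ≤ ∑ x, tensor (tpow p n) (tpow s k) x *
        Real.exp (θ * (surprisal p n k x - n * shannonH p)) ∧
      ∑ x, tensor (tpow p n) (tpow s k) x *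
        Real.exp (θ * (surprisal p n k x - n * shannonH p))
        ≤ Real.exp (n * entV p * θ ^ 2 / 2 * (1 + η)) := by
  have h1 : ∑ i, p i * (-Real.log (p i) - shannonH p) = 0 := by
    simp only [mul_sub, Finset.sum_sub_distrib, ← Finset.sum_mul, hp.2, mul_neg,
      Finset.sum_neg_distrib]
    rw [shannonH]; ring
  have h2 : ∑ i, p i * (-Real.log (p i) - shannonH p) ^ 2 = entV p :=
    Finset.sum_congr rfl fun i _ => by ring
  obtain ⟨θ₀, hθ₀, h⟩ := exists_mgf_bounds hp hV h1 h2 hη hη1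
  refine ⟨θ₀, hθ₀, fun θ hθ β _ s hs n k => ?_⟩
  obtain ⟨hl, hu⟩ := h θ hθ
  have e : ∀ z : ℝ, n * entV p * θ ^ 2 / 2 * z = n * (entV p * θ ^ 2 / 2 * z) := fun z => by ring
  rw [mgf_tensor p hs, e, e, Real.exp_nat_mul, Real.exp_nat_mul]
  exact ⟨pow_le_pow_left₀ (Real.exp_pos _).le hl n,
    pow_le_pow_left₀ ((Real.exp_pos _).le.trans hl) hu n⟩

theorem exists_upper_tail_le {α β : Type} [Fintype α] [Fintype β] {p : α → ℝ}
    (hp : IsProbDist p) (hV : 0 < entV p) {s : β → ℝ} (hs : IsProbDist s) {δ : ℝ} (hδ : 0 < δ) :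
    ∃ t₀ > 0, ∀ t : ℝ, 0 < t → t ≤ t₀ → ∀ n k : ℕ,
      ∑ x with n * shannonH p + (1 + δ) * √(2 * entV p) * (n * t) ≤ surprisal p n k x,
        tensor (tpow p n) (tpow s k) x ≤ Real.exp (-((1 + δ) * (n * t ^ 2))) := by
  obtain ⟨θ₀, hθ₀, h⟩ := exists_mgf_tensor_bounds hp hV (η := δ / (1 + δ)) (by positivity)
    (by rw [div_lt_one (by positivity)]; linarith)
  set V := entV p
  set σ := √(2 * V)
  have hσ : 0 < σ := Real.sqrt_pos.2 (by positivity)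
  have hσ2 : V = σ ^ 2 / 2 := by rw [Real.sq_sqrt (by positivity)]; ring
  refine ⟨θ₀ * σ / (2 * (1 + δ)), by positivity, fun t ht0 ht n k => ?_⟩
  have hθpos : 0 < (1 + δ) * (2 * t / σ) := by positivity
  have hθ : |(1 + δ) * (2 * t / σ)| ≤ θ₀ := by
    rw [abs_of_pos hθpos, ← mul_div_assoc, div_le_iff₀ hσ]
    rw [le_div_iff₀ (by positivity)] at ht
    linarith
  have hM := (h _ hθ hs n k).2
  refine (sum_le_exp_mul (isProbDist_tensor (isProbDist_tpow hp n) (isProbDist_tpow hs k)).1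
    (fun x => surprisal p n k x - n * shannonH p)
    (c := (1 + δ) * (2 * t / σ) * ((1 + δ) * σ * (n * t))) fun x hx =>
      mul_le_mul_of_nonneg_left (by linarith [(Finset.mem_filter.1 hx).2]) hθpos.le).trans ?_
  refine (mul_le_mul_of_nonneg_left hM (Real.exp_pos _).le).trans ?_
  rw [← Real.exp_add, Real.exp_le_exp, hσ2]
  refine le_of_eq ?_
  field_simp
  ring

theorem exists_lower_tail_le {α β : Type} [Fintype α] [Fintype β] {p : α → ℝ}
    (hp : IsProbDist p) (hH : 0 < shannonH p) (hV : 0 < entV p) {s : β → ℝ}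
    (hs : IsProbDist s) {δ : ℝ} (hδ : 0 < δ) :
    ∃ t₀ > 0, ∀ t : ℝ, 0 < t → t ≤ t₀ → ∀ (n k : ℕ) (u : ℝ), u ≤ n →
      ∑ x with surprisal p n k x ≤ u * shannonH p - (1 + δ) * √(2 * entV p) * (u * t),
        tensor (tpow p n) (tpow s k) x ≤ Real.exp (-((1 + δ) * (u * t ^ 2))) := by
  have hη1 : δ / (1 + δ) < 1 := by rw [div_lt_one (by positivity)]; linarith
  obtain ⟨θ₀, hθ₀, h⟩ := exists_mgf_tensor_bounds hp hV (η := δ / (1 + δ)) (by positivity) hη1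
  set V := entV p
  set H := shannonH p
  set σ := √(2 * V)
  have hσ : 0 < σ := Real.sqrt_pos.2 (by positivity)
  have hσ2 : V = σ ^ 2 / 2 := by rw [Real.sq_sqrt (by positivity)]; ring
  refine ⟨min θ₀ (H / V) * σ / (2 * (1 + δ)), by positivity, fun t ht0 ht n k u hu => ?_⟩
  set θ := (1 + δ) * (2 * t / σ) with hθdef
  have hθpos : 0 < θ := by positivity
  have hθ' : θ ≤ min θ₀ (H / V) := by
    rw [hθdef, ← mul_div_assoc, div_le_iff₀ hσ]
    rw [le_div_iff₀ (by positivity)] at ht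
    linarith
  obtain ⟨hθ1, hθ2⟩ := le_min_iff.1 hθ'
  rw [le_div_iff₀ hV] at hθ2
  have hM := (h (-θ) (by rwa [abs_neg, abs_of_pos hθpos]) hs n k).2
  refine (sum_le_exp_mul (isProbDist_tensor (isProbDist_tpow hp n) (isProbDist_tpow hs k)).1
    (fun x => surprisal p n k x - n * H) (θ := -θ)
    (c := -θ * (u * H - (1 + δ) * σ * (u * t) - n * H)) fun x hx =>
      mul_le_mul_of_nonpos_left (by linarith [(Finset.mem_filter.1 hx).2])
        (by linarith)).trans ?_
  refine (mul_le_mul_of_nonneg_left hM (Real.exp_pos _).le).trans ?_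
  rw [← Real.exp_add, Real.exp_le_exp]
  have key : -(-θ * (u * H - (1 + δ) * σ * (u * t) - n * H))
      + n * V * (-θ) ^ 2 / 2 * (1 + δ / (1 + δ))
      = -((1 + δ) * (u * t ^ 2))
        - (n - u) * θ * (H - V * θ / 2 * (1 + δ / (1 + δ))) := by
    rw [hσ2, hθdef]
    field_simp
    ring
  rw [key]
  have : 0 ≤ (n - u) * θ * (H - V * θ / 2 * (1 + δ / (1 + δ))) := by
    refine mul_nonneg (mul_nonneg (by linarith) hθpos.le) ?_
    have h1 : V * θ / 2 * (1 + δ / (1 + δ)) ≤ V * θ / 2 * 2 := by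
      gcongr; linarith
    linarith
  linarith

theorem exists_le_tails {α β : Type} [Fintype α] [Fintype β] {p : α → ℝ}
    (hp : IsProbDist p) (hV : 0 < entV p) {s : β → ℝ} (hs : IsProbDist s) {δ : ℝ} (hδ : 0 < δ)
    (hδ1 : δ < 1) :
    ∃ t₀ > 0, ∃ C : ℝ, ∀ t : ℝ, 0 < t → t ≤ t₀ → ∀ n k : ℕ, C ≤ n * t ^ 2 →
      2 * Real.exp (-(n * t ^ 2)) ≤
        ∑ x with n * shannonH p + (1 - δ) * √(2 * entV p) * (n * t) ≤ surprisal p n k x,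
          tensor (tpow p n) (tpow s k) x ∧
      2 * Real.exp (-(n * t ^ 2)) ≤
        ∑ x with surprisal p n k x ≤ n * shannonH p - (1 - δ) * √(2 * entV p) * (n * t),
          tensor (tpow p n) (tpow s k) x := by
  obtain ⟨θ₀, hθ₀, h⟩ := exists_mgf_tensor_bounds hp hV (η := δ ^ 2 / 64) (by positivity)
    (by nlinarith)
  set V := entV p
  set H := shannonH p
  set σ := √(2 * V)
  have hσ : 0 < σ := Real.sqrt_pos.2 (by positivity)
  have hσ2 : V = σ ^ 2 / 2 := by rw [Real.sq_sqrt (by positivity)]; ring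
  refine ⟨θ₀ * σ / 2, by positivity, Real.log 4 * 32 / δ ^ 2, fun t ht0 ht n k hC => ?_⟩
  set r := 2 * t / σ with hr
  have hr0 : 0 < r := by positivity
  have hrθ : r ≤ θ₀ := by
    rw [hr, div_le_iff₀ hσ]
    linarith
  have hAr : n * V * r ^ 2 = 2 * (n * t ^ 2) := by
    rw [hr, hσ2]; field_simp
  have hAr' : n * V * r = σ * (n * t) := by
    rw [hr, hσ2]; field_simp
  have hC' : Real.log 4 ≤ n * V * r ^ 2 * (δ ^ 2 / 64) := by
    rw [div_le_iff₀ (by positivity)] at hC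
    rw [hAr]; linarith
  have hW := (isProbDist_tensor (isProbDist_tpow hp n) (isProbDist_tpow hs k)).1
  have h1 := two_mul_exp_le_tail hW (fun x => surprisal p n k x - n * H) (by positivity) hδ hδ1
    hr0 (fun θ hθ => h θ (hθ.trans hrθ) hs n k) hC'
  have h2 := two_mul_exp_le_tail hW (fun x => -(surprisal p n k x - n * H)) (by positivity) hδ hδ1
    hr0 (fun θ hθ => by
      have := h (-θ) (by rw [abs_neg]; exact hθ.trans hrθ) hs n k
      simpa only [neg_mul, mul_neg, neg_sq] using this) hC'
  rw [hAr, hAr', mul_div_cancel_left₀ _ (two_ne_zero)] at h1 h2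
  refine ⟨h1.trans (le_of_eq ?_), h2.trans (le_of_eq ?_)⟩
  · refine Finset.sum_congr (Finset.filter_congr fun x _ => ?_) fun _ _ => rfl
    constructor <;> intro hx <;> linarith
  · refine Finset.sum_congr (Finset.filter_congr fun x _ => ?_) fun _ _ => rfl
    constructor <;> intro hx <;> linarith

theorem ModerateSeq.tendsto_mul_sq {t : ℕ → ℝ} (ht : ModerateSeq t) :
    Tendsto (fun n : ℕ => (n : ℝ) * t n ^ 2) atTop atTop := by
  have h := ht.2.atTop_mul_atTop₀ ht.2
  refine h.congr fun n => ?_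
  have := Real.mul_self_sqrt (Nat.cast_nonneg (α := ℝ) n)
  calc _ = √(n : ℝ) * √(n : ℝ) * t n ^ 2 := by ring
    _ = _ := by rw [this]

theorem ModerateSeq.eventually_pos {t : ℕ → ℝ} (ht : ModerateSeq t) :
    ∀ᶠ n in atTop, 0 < t n := by
  filter_upwards [ht.2.eventually_gt_atTop 0] with n hn
  exact pos_of_mul_pos_right hn (Real.sqrt_nonneg _)

theorem eventually_not_approxSubMajTV {α β γ : Type} [Fintype α] [Fintype β] [Fintype γ]
    {p : α → ℝ} {q : β → ℝ} {s : γ → ℝ} (hp : IsProbDist p) (hq : IsProbDist q)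
    (hs : IsProbDist s) (hsharp : IsSharp s) (hHp : 0 < shannonH p) (hHq : 0 < shannonH q)
    (hVp : 0 < entV p) (hVq : 0 < entV q) {t : ℕ → ℝ} (ht : ModerateSeq t) {κ : ℝ}
    (hκ : √(2 * entV p) + √(2 * entV q) * √(shannonH p / shannonH q) < κ) :
    ∀ᶠ n : ℕ in atTop, ∀ m : ℕ, (n * shannonH p + κ * (n * t n)) / shannonH q ≤ m →
      ¬ ApproxSubMajTV (tensor (tpow p n) (tpow s m)) (tensor (tpow q m) (tpow s n))
        (1 - Real.exp (-((n : ℝ) * t n ^ 2))) := by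
  set Hp := shannonH p
  set Hq := shannonH q
  set σp := √(2 * entV p)
  set σq := √(2 * entV q)
  set w₀ := √(Hp / Hq)
  have hσp : 0 < σp := Real.sqrt_pos.2 (by positivity)
  have hσq : 0 < σq := Real.sqrt_pos.2 (by positivity)
  have hw₀ : 0 < w₀ := Real.sqrt_pos.2 (by positivity)
  have hκ0 : 0 < κ := lt_trans (by positivity) hκ
  set S := σp + σq * w₀ with hS
  have hS0 : 0 < S := by positivity
  obtain ⟨δ₁, hδ₁, hδ₁S⟩ : ∃ δ₁ > 0, δ₁ * S = (κ - S) / 4 :=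
    ⟨(κ - S) / 4 / S, div_pos (by linarith) hS0, div_mul_cancel₀ _ hS0.ne'⟩
  obtain ⟨δ₂, hδ₂, hδ₂S⟩ : ∃ δ₂ > 0, δ₂ = (κ - S) / 4 := ⟨(κ - S) / 4, by linarith, rfl⟩
  obtain ⟨tp, htp, hP⟩ := exists_upper_tail_le hp hVp hs hδ₁
  obtain ⟨tq, htq, hQ⟩ := exists_lower_tail_le hq hHq hVq hs hδ₁
  set w : ℕ → ℝ := fun n => √((Hp + κ * t n) / Hq) with hw
  have hwlim : Tendsto w atTop (𝓝 w₀) := by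
    have : Tendsto (fun n => (Hp + κ * t n) / Hq) atTop (𝓝 ((Hp + κ * 0) / Hq)) :=
      ((ht.1.const_mul κ).const_add Hp).div_const Hq
    rw [mul_zero, add_zero] at this
    exact this.sqrt
  have hcond : ∀ᶠ n in atTop, (1 + δ₁) * (σp + σq * w n) + δ₂ < κ := by
    have : Tendsto (fun n => (1 + δ₁) * (σp + σq * w n) + δ₂) atTop (𝓝 ((1 + δ₁) * S + δ₂)) :=
      (((hwlim.const_mul σq).const_add σp).const_mul _).add_const _
    exact this.eventually_lt_const (by linarith)
  have htw : Tendsto (fun n => t n / w n) atTop (𝓝 0) := by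
    have := ht.1.div hwlim hw₀.ne'
    rwa [zero_div] at this
  have hL := ht.tendsto_mul_sq
  have hexp : ∀ᶠ n : ℕ in atTop, 2 * Real.exp (-(δ₁ * (n * t n ^ 2)))
      + Real.exp (-(n * t n ^ 2)) < 1 := by
    have h1 : Tendsto (fun n : ℕ => Real.exp (-(δ₁ * (n * t n ^ 2)))) atTop (𝓝 0) :=
      Real.tendsto_exp_neg_atTop_nhds_zero.comp (hL.const_mul_atTop hδ₁)
    have h2 : Tendsto (fun n : ℕ => Real.exp (-(n * t n ^ 2))) atTop (𝓝 0) :=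
      Real.tendsto_exp_neg_atTop_nhds_zero.comp hL
    have h3 := (h1.const_mul 2).add h2
    rw [mul_zero, add_zero] at h3
    exact h3.eventually_lt_const one_pos
  filter_upwards [hcond, htw.eventually_le_const htq, ht.1.eventually_le_const htp,
    ht.1.eventually_le_const (half_pos hδ₂), hexp, ht.eventually_pos]
    with n hcond htqn htpn htδ hexp ht0 m hm hfeas
  have hwpos : 0 < w n := Real.sqrt_pos.2 (by positivity)
  have hw2 : w n ^ 2 = (Hp + κ * t n) / Hq := Real.sq_sqrt (by positivity)
  have hnt : 0 ≤ (n : ℝ) * t n := by positivity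
  set a := n * Hp + (1 + δ₁) * σp * (n * t n) with ha
  set b := a + δ₂ * (n * t n) with hb
  have hu : (n : ℝ) * w n ^ 2 ≤ m := by
    refine le_trans (le_of_eq ?_) hm
    rw [hw2]; ring
  have hPd := isProbDist_tensor (isProbDist_tpow hp n) (isProbDist_tpow hs m)
  have hQd := isProbDist_tensor (isProbDist_tpow hq m) (isProbDist_tpow hs n)
  have h1 := le_headSum_floor_of_isSurprisal hPd (isSurprisal_tensor hp hsharp n m) a
  have h2 : 1 - Real.exp (-((1 + δ₁) * (n * t n ^ 2)))
      ≤ ∑ x with surprisal p n m x ≤ a, tensor (tpow p n) (tpow s m) x := by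
    have h3 := hP (t n) ht0 htpn n m
    have h4 := Finset.sum_filter_add_sum_filter_not Finset.univ
      (fun x => surprisal p n m x ≤ a) (tensor (tpow p n) (tpow s m))
    rw [hPd.2] at h4
    have h5 : ∑ x with ¬ surprisal p n m x ≤ a, tensor (tpow p n) (tpow s m) x
        ≤ ∑ x with a ≤ surprisal p n m x, tensor (tpow p n) (tpow s m) x :=
      Finset.sum_le_sum_of_subset_of_nonneg
        (Finset.monotone_filter_right _ fun x _ hx => (not_le.1 hx).le) fun x _ _ => hPd.1 x
    linarith
  have h3 := headSum_le_of_isSurprisal hQd (isSurprisal_tensor hq hsharp m n) (b := b)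
    (Nat.floor_le (Real.exp_pos a).le)
  have h4 : ∑ x with surprisal q m n x < b, tensor (tpow q m) (tpow s n) x
      ≤ Real.exp (-((1 + δ₁) * (n * t n ^ 2))) := by
    have h5 := hQ (t n / w n) (by positivity) htqn m n (n * w n ^ 2) hu
    have e1 : n * w n ^ 2 * (t n / w n) ^ 2 = n * t n ^ 2 := by field_simp
    have e2 : n * w n ^ 2 * (t n / w n) = n * t n * w n := by field_simp
    rw [e1, e2] at h5
    refine le_trans ?_ h5
    refine Finset.sum_le_sum_of_subset_of_nonneg
      (Finset.monotone_filter_right _ fun x _ hx => ?_) fun x _ _ => hQd.1 x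
    refine (le_of_lt hx).trans ?_
    have e3 : n * w n ^ 2 * Hq = n * Hp + κ * (n * t n) := by
      rw [hw2]; field_simp
    have e4 := mul_le_mul_of_nonneg_right hcond.le hnt
    change b ≤ n * w n ^ 2 * Hq - (1 + δ₁) * σq * (n * t n * w n)
    rw [e3]
    linarith
  have h5 := hfeas.headSum_le hQd ⌊Real.exp a⌋₊
  have h6 : Real.exp (a - b) ≤ Real.exp (-(n * t n ^ 2)) * Real.exp (-(n * t n ^ 2)) := by
    rw [← Real.exp_add, Real.exp_le_exp]
    have := mul_le_mul_of_nonneg_right htδ hnt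
    linarith
  have h7 : Real.exp (-((1 + δ₁) * (n * t n ^ 2)))
      = Real.exp (-(δ₁ * (n * t n ^ 2))) * Real.exp (-(n * t n ^ 2)) := by
    rw [← Real.exp_add]; ring_nf
  have h8 := mul_lt_mul_of_pos_right hexp (Real.exp_pos (-(n * t n ^ 2)))
  linarith

theorem eventually_exists_approxSubMajTV {α β γ : Type} [Fintype α] [Fintype β] [Fintype γ]
    {p : α → ℝ} {q : β → ℝ} {s : γ → ℝ} (hp : IsProbDist p) (hq : IsProbDist q)
    (hs : IsProbDist s) (hsharp : IsSharp s) (hHp : 0 < shannonH p) (hHq : 0 < shannonH q)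
    (hVp : 0 < entV p) (hVq : 0 < entV q) {t : ℕ → ℝ} (ht : ModerateSeq t) {κ : ℝ}
    (hκ : κ < √(2 * entV p) + √(2 * entV q) * √(shannonH p / shannonH q)) :
    ∀ᶠ n : ℕ in atTop, ∃ m : ℕ, (n * shannonH p + κ * (n * t n)) / shannonH q ≤ m ∧
      ApproxSubMajTV (tensor (tpow p n) (tpow s m)) (tensor (tpow q m) (tpow s n))
        (1 - Real.exp (-((n : ℝ) * t n ^ 2))) := by
  set Hp := shannonH p
  set Hq := shannonH q
  set σp := √(2 * entV p)
  set σq := √(2 * entV q)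
  set w₀ := √(Hp / Hq)
  have hσp : 0 < σp := Real.sqrt_pos.2 (by positivity)
  have hσq : 0 < σq := Real.sqrt_pos.2 (by positivity)
  have hw₀ : 0 < w₀ := Real.sqrt_pos.2 (by positivity)
  set S := σp + σq * w₀ with hS
  have hS0 : 0 < S := by positivity
  obtain ⟨δ₁, hδ₁, hδ₁1, hδ₁S⟩ : ∃ δ₁ > 0, δ₁ < 1 ∧ δ₁ * S ≤ (S - κ) / 2 :=
    ⟨min (1 / 2) ((S - κ) / 2 / S),
      lt_min (by norm_num) (div_pos (by linarith) hS0),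
      (min_le_left _ _).trans_lt (by norm_num),
      (le_div_iff₀ hS0).1 (min_le_right _ _)⟩
  obtain ⟨δ₂, hδ₂, hδ₂S⟩ : ∃ δ₂ > 0, δ₂ = (S - κ) / 8 := ⟨(S - κ) / 8, by linarith, rfl⟩
  obtain ⟨tp, htp, Cp, hP⟩ := exists_le_tails hp hVp hs hδ₁ hδ₁1
  obtain ⟨tq, htq, Cq, hQ⟩ := exists_le_tails hq hVq hs hδ₁ hδ₁1
  set m : ℕ → ℕ := fun n => ⌈(n * Hp + κ * (n * t n)) / Hq⌉₊ with hmdef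
  set w : ℕ → ℝ := fun n => √(m n / n) with hw
  have hbase : Tendsto (fun n => (Hp + κ * t n) / Hq) atTop (𝓝 (Hp / Hq)) := by
    have : Tendsto (fun n => (Hp + κ * t n) / Hq) atTop (𝓝 ((Hp + κ * 0) / Hq)) :=
      ((ht.1.const_mul κ).const_add Hp).div_const Hq
    rwa [mul_zero, add_zero] at this
  have hbase_pos : ∀ᶠ n in atTop, 0 < (Hp + κ * t n) / Hq :=
    hbase.eventually_const_lt (by positivity)
  have hm_le : ∀ᶠ n : ℕ in atTop, (m n : ℝ) ≤ (n * Hp + κ * (n * t n)) / Hq + 1 := by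
    filter_upwards [hbase_pos] with n hn
    refine (Nat.ceil_lt_add_one ?_).le
    have : (n * Hp + κ * (n * t n)) / Hq = n * ((Hp + κ * t n) / Hq) := by ring
    rw [this]; positivity
  have hwlim : Tendsto w atTop (𝓝 w₀) := by
    refine Tendsto.sqrt ?_
    have hup : Tendsto (fun n : ℕ => (Hp + κ * t n) / Hq + 1 / (n : ℝ)) atTop
        (𝓝 (Hp / Hq)) := by
      have := hbase.add tendsto_one_div_atTop_nhds_zero_nat
      rwa [add_zero] at this
    refine tendsto_of_tendsto_of_tendsto_of_le_of_le' hbase hup ?_ ?_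
    · filter_upwards [eventually_gt_atTop 0] with n hn
      have hn' : (0 : ℝ) < n := Nat.cast_pos.2 hn
      rw [le_div_iff₀ hn']
      refine le_trans (le_of_eq ?_) (Nat.le_ceil _)
      ring
    · filter_upwards [eventually_gt_atTop 0, hm_le] with n hn hmn
      have hn' : (0 : ℝ) < n := Nat.cast_pos.2 hn
      rw [div_le_iff₀ hn']
      refine hmn.trans (le_of_eq ?_)
      field_simp
  have hcond : ∀ᶠ n in atTop, κ + 2 * δ₂ < (1 - δ₁) * (σp + σq * w n) := by
    have : Tendsto (fun n => (1 - δ₁) * (σp + σq * w n)) atTop (𝓝 ((1 - δ₁) * S)) :=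
      ((hwlim.const_mul σq).const_add σp).const_mul _
    exact this.eventually_const_lt (by linarith)
  have htw : Tendsto (fun n => t n / w n) atTop (𝓝 0) := by
    have := ht.1.div hwlim hw₀.ne'
    rwa [zero_div] at this
  have hL := ht.tendsto_mul_sq
  filter_upwards [hcond, hm_le, htw.eventually_le_const htq, ht.1.eventually_le_const htp,
    ht.1.eventually_le_const hδ₂, ht.1.eventually_le_const one_pos, ht.eventually_pos,
    hL.eventually_ge_atTop Cp, hL.eventually_ge_atTop Cq, hL.eventually_ge_atTop (Hq / δ₂),
    hwlim.eventually_const_lt hw₀, eventually_gt_atTop 0]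
    with n hcond hmle htqn htpn htδ ht1 ht0 hCp hCq hHL hwpos hn
  refine ⟨m n, Nat.le_ceil _, ?_⟩
  have hn' : (0 : ℝ) < n := Nat.cast_pos.2 hn
  have hw2 : (m n : ℝ) = n * w n ^ 2 := by
    rw [hw, Real.sq_sqrt (by positivity)]; field_simp
  have hnt : 0 ≤ (n : ℝ) * t n := by positivity
  set b := n * Hp + (1 - δ₁) * σp * (n * t n) with hb
  set a := b - δ₂ * (n * t n) with ha
  have hPd := isProbDist_tensor (isProbDist_tpow hp n) (isProbDist_tpow hs (m n))
  have hQd := isProbDist_tensor (isProbDist_tpow hq (m n)) (isProbDist_tpow hs n)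
  have hLpos : 0 < Real.exp (-((n : ℝ) * t n ^ 2)) := Real.exp_pos _
  refine approxSubMajTV_of_headSum hPd hQd hLpos
    (Real.exp_le_one_iff.2 (neg_nonpos.2 (by positivity))) (j := ⌊Real.exp a⌋₊) ?_ ?_
  · have h1 := le_headSum_floor_of_isSurprisal hQd (isSurprisal_tensor hq hsharp (m n) n) a
    have e1 : m n * (t n / w n) ^ 2 = n * t n ^ 2 := by rw [hw2]; field_simp
    have e2 : m n * (t n / w n) = n * t n * w n := by rw [hw2]; field_simp
    have h2 := (hQ (t n / w n) (by positivity) htqn (m n) n (by rw [e1]; exact hCq)).2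
    rw [e1, e2] at h2
    have h3 : ∑ x with surprisal q (m n) n x ≤ m n * shannonH q
          - (1 - δ₁) * √(2 * entV q) * (n * t n * w n), tensor (tpow q (m n)) (tpow s n) x
        ≤ ∑ x with surprisal q (m n) n x ≤ a, tensor (tpow q (m n)) (tpow s n) x := by
      refine Finset.sum_le_sum_of_subset_of_nonneg
        (Finset.monotone_filter_right _ fun x _ hx => ?_) fun x _ _ => hQd.1 x
      refine le_trans hx ?_
      change m n * Hq - (1 - δ₁) * σq * (n * t n * w n) ≤ a
      have e3 : (m n : ℝ) * Hq ≤ n * Hp + κ * (n * t n) + Hq := by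
        refine (mul_le_mul_of_nonneg_right hmle hHq.le).trans (le_of_eq ?_)
        field_simp
      have e4 := mul_le_mul_of_nonneg_right hcond.le hnt
      have e5 : Hq ≤ δ₂ * (n * t n) := by
        rw [div_le_iff₀ hδ₂] at hHL
        have : n * t n ^ 2 ≤ n * t n := by
          have := mul_le_mul_of_nonneg_left ht1 hnt
          linarith
        have := mul_le_mul_of_nonneg_right this hδ₂.le
        linarith
      linarith
    linarith
  · have h1 := headSum_le_of_isSurprisal hPd (isSurprisal_tensor hp hsharp n (m n)) (b := b)
      (Nat.floor_le (Real.exp_pos a).le)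
    have h2 := (hP (t n) ht0 htpn n (m n) hCp).1
    have h3 : ∑ x with surprisal p n (m n) x < b, tensor (tpow p n) (tpow s (m n)) x
        + ∑ x with b ≤ surprisal p n (m n) x, tensor (tpow p n) (tpow s (m n)) x = 1 := by
      rw [← hPd.2, ← Finset.sum_filter_add_sum_filter_not Finset.univ
        (fun x => surprisal p n (m n) x < b)]
      simp only [not_lt]
    have h4 : Real.exp (a - b) ≤ Real.exp (-(n * t n ^ 2)) := by
      rw [Real.exp_le_exp]
      have := mul_le_mul_of_nonneg_right htδ hnt
      linarith
    change 2 * Real.exp (-(n * t n ^ 2)) ≤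
      ∑ x with b ≤ surprisal p n (m n) x, tensor (tpow p n) (tpow s (m n)) x at h2
    linarith

/-- Moderate deviation expansion of the optimal entanglement-direction conversion rate
in the converse regime (total variation error `ε_n = 1 - e^{-n t_n²}`). -/
theorem entanglement_direction_converse
    {dp dq ds : ℕ} (p : Fin dp → ℝ) (q : Fin dq → ℝ) (s : Fin ds → ℝ)
    (hp : IsProbDist p) (hq : IsProbDist q)
    (hs : IsProbDist s) (hsharp : IsSharp s)
    (hHp : 0 < shannonH p) (hHq : 0 < shannonH q)
    (hVp : 0 < entV p) (hVq : 0 < entV q)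
    (t : ℕ → ℝ) (ht : ModerateSeq t)
    (ε : ℕ → ℝ) (hε : ∀ n : ℕ, ε n = 1 - Real.exp (-((n : ℝ) * t n ^ 2)))
    (R : ℕ → ℝ → ℝ)
    (hR : ∀ n : ℕ, ∀ e : ℝ, 0 ≤ e → R n e =
      (↑(sSup {m : ℕ | ApproxSubMajTV (tensor (tpow p n) (tpow s m))
          (tensor (tpow q m) (tpow s n)) e}) : ℝ) / (n : ℝ))
    (ν : ℝ) (hν : ν = (entV p / shannonH p) / (entV q / shannonH q)) :
    Tendsto (fun n : ℕ => (R n (ε n) - shannonH p / shannonH q) / t n) atTop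
      (𝓝 (Real.sqrt (2 * entV p) / shannonH q * (1 + 1 / Real.sqrt ν))) := by
  have hc : √(2 * entV p) / shannonH q * (1 + 1 / √ν)
      = (√(2 * entV p) + √(2 * entV q) * √(shannonH p / shannonH q)) / shannonH q := by
    have e : √(2 * entV p) = √(2 * entV q) * √(shannonH p / shannonH q) * √ν := by
      rw [← Real.sqrt_mul (by positivity), ← Real.sqrt_mul (by positivity), hν]
      congr 1
      field_simp
    have hν0 : 0 < √ν := Real.sqrt_pos.2 (by rw [hν]; positivity)
    have e' : √(2 * entV p) * (1 / √ν) = √(2 * entV q) * √(shannonH p / shannonH q) := by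
      rw [mul_one_div, div_eq_iff hν0.ne']
      exact e
    rw [div_mul_eq_mul_div, mul_add, mul_one, e']
  rw [hc]
  set S := √(2 * entV p) + √(2 * entV q) * √(shannonH p / shannonH q) with hS
  rw [Metric.tendsto_nhds]
  intro d hd
  have hdH : 0 < shannonH q * (d / 2) := by positivity
  filter_upwards [
    eventually_not_approxSubMajTV hp hq hs hsharp hHp hHq hVp hVq ht
      (κ := S + shannonH q * (d / 2)) (by linarith),
    eventually_exists_approxSubMajTV hp hq hs hsharp hHp hHq hVp hVq ht
      (κ := S - shannonH q * (d / 2)) (by linarith),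
    ht.eventually_pos, eventually_gt_atTop 0] with n hup hlow ht0 hn
  have hn' : (0 : ℝ) < n := Nat.cast_pos.2 hn
  have hε0 : 0 ≤ ε n := by
    rw [hε, sub_nonneg]
    exact Real.exp_le_one_iff.2 (neg_nonpos.2 (by positivity))
  rw [hR n (ε n) hε0, hε n]
  set F := {m : ℕ | ApproxSubMajTV (tensor (tpow p n) (tpow s m))
    (tensor (tpow q m) (tpow s n)) (1 - Real.exp (-((n : ℝ) * t n ^ 2)))} with hF
  have hFub : ∀ m ∈ F, (m : ℝ)
      < (n * shannonH p + (S + shannonH q * (d / 2)) * (n * t n)) / shannonH q :=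
    fun m hm => not_le.1 fun h => hup m h hm
  obtain ⟨m₀, hm₀, hm₀F⟩ := hlow
  have hbdd : BddAbove F :=
    ⟨⌈(n * shannonH p + (S + shannonH q * (d / 2)) * (n * t n)) / shannonH q⌉₊, fun m hm =>
      Nat.cast_le.1 ((hFub m hm).le.trans (Nat.le_ceil _))⟩
  have h1 := hFub _ (Nat.sSup_mem ⟨m₀, hm₀F⟩ hbdd)
  have h2 : (m₀ : ℝ) ≤ (sSup F : ℕ) := Nat.cast_le.2 (le_csSup hbdd hm₀F)
  have h3 := hm₀.trans h2
  rw [lt_div_iff₀ hHq] at h1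
  rw [div_le_iff₀ hHq] at h3
  set M : ℝ := ((sSup F : ℕ) : ℝ)
  have key : (M / n - shannonH p / shannonH q) / t n - S / shannonH q
      = (M * shannonH q - n * shannonH p - S * (n * t n)) / (shannonH q * (n * t n)) := by
    field_simp
  have hpos : 0 < shannonH q * (n * t n) := by positivity
  rw [Real.dist_eq, key, abs_lt, lt_div_iff₀ hpos, div_lt_iff₀ hpos]
  have h4 : 0 < d * (shannonH q * (n * t n)) := by positivity
  constructor <;> linarith
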